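/- Let θ = exp(2πi/7), let k ∈ {3, 5}, and set φ = θ^k. Define 3×3 complex matrices A = [[1, φ/θ + θ, θ], [0, θ, θ], [0, 0, φ]] and B = [[φ, 0, 0], [−θ, θ, 0], [θ, −φ/θ − θ, 1]]. Then the subgroup of GL(3,ℂ) generated by A and B is finite. -/

import Mathlib

/-- The subgroup of `GL(3, ℂ)` generated by the (invertible) matrices `A` and `B`. -/
def matGenGroup (A B : Matrix (Fin 3) (Fin 3) ℂ) :
    Subgroup (Matrix (Fin 3) (Fin 3) ℂ)ˣ :=
  Subgroup.closure {g : (Matrix (Fin 3) (Fin 3) ℂ)ˣ |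
    (g : Matrix (Fin 3) (Fin 3) ℂ) = A ∨ (g : Matrix (Fin 3) (Fin 3) ℂ) = B}

open Matrix

/-- A group of invertible matrices is finite if its generators map a finite set of vectors to
itself and that set contains the rows of an invertible matrix. -/
theorem finite_closure_of_mapsTo_mulVec {n K : Type*} [Fintype n] [DecidableEq n] [CommRing K]
    {G : Set (Matrix n n K)ˣ} {S : Set (n → K)} (hS : S.Finite)
    {P : Matrix n n K} (hP : IsUnit P.det) (hPS : ∀ i, P.row i ∈ S)
    (hG : ∀ g ∈ G, Set.MapsTo ((g : Matrix n n K) *ᵥ ·) S S) :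
    (Subgroup.closure G : Set (Matrix n n K)ˣ).Finite := by
  have maps : ∀ g ∈ Subgroup.closure G, Set.MapsTo ((g : Matrix n n K) *ᵥ ·) S S := by
    intro g hg
    induction hg using Subgroup.closure_induction with
    | mem g hg => exact hG g hg
    | one => intro v hv; simpa using hv
    | mul g h _ _ hg hh =>
      intro v hv
      simpa [mulVec_mulVec] using hg (hh hv)
    | inv g _ hg =>
      have inj : Set.InjOn ((g : Matrix n n K) *ᵥ ·) S := fun v _ w _ h => by
        simpa [mulVec_mulVec] using congrArg ((g⁻¹ : (Matrix n n K)ˣ).val *ᵥ ·) h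
      intro v hv
      obtain ⟨w, hw, rfl⟩ := ((hS.injOn_iff_bijOn_of_mapsTo hg).1 inj).surjOn hv
      simpa [mulVec_mulVec] using hw
  refine Set.Finite.of_finite_image (f := fun g i => (g : Matrix n n K) *ᵥ P.row i)
    ((Set.Finite.pi' fun _ => hS).subset ?_) ?_
  · rintro _ ⟨g, hg, rfl⟩ i
    exact maps g hg (hPS i)
  · intro g _ h _ hgh
    have key : (g : Matrix n n K) * Pᵀ = h * Pᵀ := by
      ext i j
      exact congrFun (congrFun hgh j) i
    exact Units.ext ((((isUnit_iff_isUnit_det _).2 (by rwa [det_transpose])).mul_left_inj).1 key)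

/-- In the Klein representation of `PSL(2, 7)`, an element of order seven with eigenvalues
`a`, `b` and `(a * b)⁻¹`. -/
def kleinRotation {K : Type*} [CommRing K] (a b : K) : Matrix (Fin 3) (Fin 3) K :=
  !![a, b^5 + b, b; 0, b, b; 0, 0, a^6 * b^6]

/-- In the Klein representation of `PSL(2, 7)`, an involution. -/
def kleinInvolution (K : Type*) [CommRing K] : Matrix (Fin 3) (Fin 3) K :=
  !![0, 0, 1; 0, -1, 0; 1, 0, 0]

/-- Representatives modulo sign of the 42 roots of the complex reflection group `PSL(2, 7) × {±1}`,
arranged in the three orbits of `kleinRotation a b`. -/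
def kleinRoot {K : Type*} [CommRing K] (a b : K) : Fin 3 → Fin 7 → Fin 3 → K :=
  ![![![1, 0, 1],
      ![a + b, b, a^6 * b^6],
      ![-1 - a^5 * b^5, a^6 + b^2, a^5 * b^5],
      ![1 + a^3 + b^3, a + a^3 + b^3, a^4 * b^4],
      ![1 + a^4 + b^4, -a^4 - a^6 - a^3 * b^3, a^3 * b^3],
      ![-1 - a^2 * b^2, -a - a^2 * b^2, a^2 * b^2],
      ![a^6 + b^6, -a * b, a * b]],
    ![![a^6 * b^6, -b, a + b],
      ![a * b, a * b, a^6 + b^6],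
      ![-a * b - a^3 * b^3, 1 + a^6 * b + a * b^2, a * b + a^3 * b^3],
      ![-a^2 * b^2, -a - a^2 * b^2, 1 + a^2 * b^2],
      ![-1 - a * b - a^6 * b^6, b - a * b, a * b + a^6 * b^6],
      ![-a^5 * b^5, a^6 + b^2, 1 + a^5 * b^5],
      ![-a^2 * b - a * b^2, -1 - a^2 * b - a * b^2, a^2 * b + a * b^2]],
    ![![a^4 * b^4, -a - a^3 - b^3, 1 + a^3 + b^3],
      ![-a * b - a^6 * b^6, b - a * b, 1 + a * b + a^6 * b^6],
      ![a^3 * b^3, a^4 + a^6 + a^3 * b^3, 1 + a^4 + b^4],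
      ![a^3 + b^3 + a^3 * b^3, a^4 * b - 1 - a * b^2, a^4 + a * b^2 + a^3 * b^6],
      ![-a - b - a^4 * b^4, a + a^3 + b^3 - b, a + b + a^4 * b^4],
      ![-a^6 - a^3 * b^3 - b^6, a * b - a^4 - a^6 - a^3 * b^3, a^6 + a^3 * b^3 + b^6],
      ![a^4 + a * b^2 + a^3 * b^6, 1 + a * b^2 - a^4 * b, a^3 + b^3 + a^3 * b^3]]]

section KleinOrbit

variable {K : Type*} [CommRing K] {a b : K}

set_option maxHeartbeats 4000000 in
theorem kleinRotation_mulVec_kleinRoot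
    (hb : 1 + b + b^2 + b^3 + b^4 + b^5 + b^6 = 0) (ha : a^2 = (b^2 + b^4) * a - b^6)
    (m : Fin 3) (j : Fin 7) :
    kleinRotation a b *ᵥ kleinRoot a b m j = kleinRoot a b m (j + 1) := by
  fin_cases m <;> fin_cases j <;> ext i <;> fin_cases i <;>
    simp [kleinRotation, kleinRoot, mulVec, dotProduct, Fin.sum_univ_three] <;> grind

set_option maxHeartbeats 4000000 in
theorem kleinInvolution_mulVec_kleinRoot (a b : K) (m : Fin 3) (j : Fin 7) :
    ∃ m' j', kleinInvolution K *ᵥ kleinRoot a b m j = kleinRoot a b m' j' ∨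
      kleinInvolution K *ᵥ kleinRoot a b m j = -kleinRoot a b m' j' := by
  let p : Fin 3 → Fin 7 → Fin 3 × Fin 7 :=
    ![![(0, 0), (1, 0), (1, 5), (2, 0), (2, 2), (1, 3), (1, 1)],
      ![(0, 1), (0, 6), (1, 2), (0, 5), (2, 1), (0, 2), (1, 6)],
      ![(0, 3), (1, 4), (0, 4), (2, 6), (2, 4), (2, 5), (2, 3)]]
  let s : Fin 3 → Fin 7 → ℤˣ :=
    ![![1, 1, -1, 1, 1, -1, 1], ![1, 1, -1, -1, -1, -1, -1], ![1, -1, 1, 1, -1, -1, 1]]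
  have key : kleinInvolution K *ᵥ kleinRoot a b m j =
      (s m j : ℤ) • kleinRoot a b (p m j).1 (p m j).2 := by
    fin_cases m <;> fin_cases j <;> ext i <;> fin_cases i <;>
      simp [p, s, kleinInvolution, kleinRoot, mulVec, dotProduct, Fin.sum_univ_three] <;> ring
  refine ⟨(p m j).1, (p m j).2, (Int.units_eq_one_or (s m j)).imp (fun h => ?_) fun h => ?_⟩ <;>
    simpa [h] using key

theorem isUnit_det_kleinRoot
    (hb : 1 + b + b^2 + b^3 + b^4 + b^5 + b^6 = 0) (ha : a^2 = (b^2 + b^4) * a - b^6) :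
    IsUnit (of ![kleinRoot a b 0 0, kleinRoot a b 0 1, kleinRoot a b 0 2]).det := by
  refine IsUnit.of_mul_eq_one (1 + a^4 * b^2 + a^5 * b^2) ?_
  simp [kleinRoot, det_fin_three]
  grind

/-- The multiples of the Klein roots by the 14th roots of unity. -/
def kleinOrbit (a b : K) : Set (Fin 3 → K) :=
  {v | ∃ c : K, c^14 = 1 ∧ ∃ m j, v = c • kleinRoot a b m j}

theorem finite_kleinOrbit [IsDomain K] (a b : K) : (kleinOrbit a b).Finite := by
  have h : {c : K | c^14 = 1}.Finite :=
    (Polynomial.nthRootsFinset 14 (1 : K)).finite_toSet.subset fun c hc =>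
      (Polynomial.mem_nthRootsFinset (by norm_num) 1).2 hc
  refine (h.image2 (fun c v => c • v)
    (Set.finite_range fun p : Fin 3 × Fin 7 => kleinRoot a b p.1 p.2)).subset ?_
  rintro _ ⟨c, hc, m, j, rfl⟩
  exact ⟨c, hc, _, ⟨(m, j), rfl⟩, rfl⟩

theorem smul_mem_kleinOrbit {s : K} (hs : s^7 = 1) {v : Fin 3 → K} (hv : v ∈ kleinOrbit a b) :
    s • v ∈ kleinOrbit a b := by
  obtain ⟨c, hc, m, j, rfl⟩ := hv
  exact ⟨s * c, by linear_combination s^14 * hc + (s^7 + 1) * hs, m, j, smul_smul s c _⟩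

theorem kleinRotation_mulVec_mem_kleinOrbit
    (hb : 1 + b + b^2 + b^3 + b^4 + b^5 + b^6 = 0) (ha : a^2 = (b^2 + b^4) * a - b^6)
    {v : Fin 3 → K} (hv : v ∈ kleinOrbit a b) : kleinRotation a b *ᵥ v ∈ kleinOrbit a b := by
  obtain ⟨c, hc, m, j, rfl⟩ := hv
  exact ⟨c, hc, m, j + 1, by rw [mulVec_smul, kleinRotation_mulVec_kleinRoot hb ha]⟩

theorem kleinInvolution_mulVec_mem_kleinOrbit {v : Fin 3 → K} (hv : v ∈ kleinOrbit a b) :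
    kleinInvolution K *ᵥ v ∈ kleinOrbit a b := by
  obtain ⟨c, hc, m, j, rfl⟩ := hv
  obtain ⟨m', j', h | h⟩ := kleinInvolution_mulVec_kleinRoot a b m j
  · exact ⟨c, hc, m', j', by rw [mulVec_smul, h]⟩
  · exact ⟨-c, by rw [← hc]; ring, m', j', by rw [mulVec_smul, h, smul_neg, neg_smul]⟩

end KleinOrbit

theorem finite_matGenGroup_klein {a b s : ℂ}
    (hb : 1 + b + b^2 + b^3 + b^4 + b^5 + b^6 = 0) (ha : a^2 = (b^2 + b^4) * a - b^6)
    (hs : s^7 = 1) :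
    (matGenGroup (s • kleinRotation a b)
      (s • (kleinInvolution ℂ * kleinRotation a b * kleinInvolution ℂ)) :
        Set (Matrix (Fin 3) (Fin 3) ℂ)ˣ).Finite := by
  refine finite_closure_of_mapsTo_mulVec (finite_kleinOrbit a b) (isUnit_det_kleinRoot hb ha) ?_ ?_
  · intro i
    refine ⟨1, one_pow _, 0, ![0, 1, 2] i, ?_⟩
    fin_cases i <;> simp [row] <;> rfl
  · rintro g (hg | hg) v hv
    · simpa [hg, smul_mulVec] using
        smul_mem_kleinOrbit hs (kleinRotation_mulVec_mem_kleinOrbit hb ha hv)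
    · simpa [hg, smul_mulVec, mulVec_mulVec, mul_assoc] using
        smul_mem_kleinOrbit hs (kleinInvolution_mulVec_mem_kleinOrbit
          (kleinRotation_mulVec_mem_kleinOrbit hb ha
            (kleinInvolution_mulVec_mem_kleinOrbit hv)))

theorem stmt15 (θ φ : ℂ) (k : ℕ)
    (hθ : θ = Complex.exp (2 * Real.pi * Complex.I / 7))
    (hk : k ∈ ({3, 5} : Set ℕ)) (hφ : φ = θ ^ k)
    (A B : Matrix (Fin 3) (Fin 3) ℂ)
    (hA : A = !![1, φ / θ + θ, θ; 0, θ, θ; 0, 0, φ])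
    (hB : B = !![φ, 0, 0; -θ, θ, 0; θ, -φ / θ - θ, 1]) :
    Set.Finite (matGenGroup A B : Set (Matrix (Fin 3) (Fin 3) ℂ)ˣ) := by
  have hprim : IsPrimitiveRoot θ 7 := hθ ▸ Complex.isPrimitiveRoot_exp 7 (by norm_num)
  have hsum : 1 + θ + θ^2 + θ^3 + θ^4 + θ^5 + θ^6 = 0 := by
    simpa [Finset.sum_range_succ] using hprim.geom_sum_eq_zero (by norm_num)
  have h7 : θ^7 = 1 := hprim.pow_eq_one
  have h0 : θ ≠ 0 := hprim.ne_zero (by norm_num)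
  have hdiv : φ / θ = φ * θ^6 := by
    field_simp
    linear_combination -φ * h7
  have hA' : A = !![1, φ * θ^6 + θ, θ; 0, θ, θ; 0, 0, φ] := by rw [hA, hdiv]
  have hB' : B = !![φ, 0, 0; -θ, θ, 0; θ, -(φ * θ^6) - θ, 1] := by rw [hB, neg_div, hdiv]
  obtain ⟨a, b, s, hb, ha, hs, hsa, hsb, hφs, hoff⟩ : ∃ a b s : ℂ,
      1 + b + b^2 + b^3 + b^4 + b^5 + b^6 = 0 ∧ a^2 = (b^2 + b^4) * a - b^6 ∧ s^7 = 1 ∧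
      s * a = 1 ∧ s * b = θ ∧ s * (a^6 * b^6) = φ ∧ s * b^5 = φ * θ^6 := by
    clear hA hB hA' hB' hdiv hθ hprim h0
    rcases hk with rfl | rfl
    · refine ⟨θ, θ^2, θ^6, ?_, ?_, ?_, ?_, ?_, ?_, ?_⟩ <;> grind
    · refine ⟨θ^5, θ^6, θ^2, ?_, ?_, ?_, ?_, ?_, ?_, ?_⟩ <;> grind
  have hAs : A = s • kleinRotation a b := by
    ext i j
    fin_cases i <;> fin_cases j <;> simp [hA', kleinRotation, mul_add, hsa, hsb, hφs, hoff]
  have hBs : B = s • (kleinInvolution ℂ * kleinRotation a b * kleinInvolution ℂ) := by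
    ext i j
    fin_cases i <;> fin_cases j <;>
      simp [hB', kleinRotation, kleinInvolution, mul_add, hsa, hsb, hφs, hoff]
    ring
  rw [hAs, hBs]
  exact finite_matGenGroup_klein hb ha hs
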